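/- Let d ≥ 1 and let E ⊂ ℤ^d be a finite nonempty set contained in the ball B_∞(R) = {x ∈ ℝ^d : ‖x‖_∞ ≤ R} for some R ≥ 2. Then there is a constant C (depending only on d) such that for all 1 ≤ m ≤ |E| the Kolmogorov numbers of the Fourier projection satisfy d_m(S_E : L₂(𝕋^d) → L_∞(𝕋^d)) ≤ C (|E| log R / m)^{1/2}. -/

import Mathlib

open MeasureTheory Real
open scoped ENNReal ComplexConjugate

noncomputable section

instance : Fact (0 < 2 * π) := ⟨by positivity⟩

/-- The `d`-dimensional torus `[0, 2π]^d`. -/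
abbrev Torus (d : ℕ) := Fin d → AddCircle (2 * π)

/-- The multivariate trigonometric character `x ↦ e^{i k · x}`. -/
def trigChar {d : ℕ} (k : Fin d → ℤ) : C(Torus d, ℂ) :=
  ⟨fun x => ∏ j, fourier (k j) (x j),
    continuous_finset_prod _ fun j _ => (map_continuous (fourier (k j))).comp (continuous_apply j)⟩

/-- The Fourier coefficient `f̂(k) = (2π)^{-d} ∫ f(x) e^{-i k·x} dx`. -/
def fCoeff {d : ℕ} (f : Torus d → ℂ) (k : Fin d → ℤ) : ℂ :=
  ((2 * π) ^ d)⁻¹ • ∫ x : Torus d, conj (trigChar k x) * f x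

/-- A continuous function on the torus, considered as an element of `L_∞`. -/
def toLinfty {d : ℕ} (g : C(Torus d, ℂ)) : Lp ℂ ∞ (volume : Measure (Torus d)) :=
  ContinuousMap.toLp ∞ (volume : Measure (Torus d)) ℂ g

/-- The Fourier projection `S_E f = ∑_{k ∈ E} f̂(k) e^{i k·x}`, as an operator from
`L_q(𝕋^d)` to `L_∞(𝕋^d)`. -/
def SE (d : ℕ) (q : ℝ≥0∞) (E : Finset (Fin d → ℤ))
    (f : Lp ℂ q (volume : Measure (Torus d))) : Lp ℂ ∞ (volume : Measure (Torus d)) :=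
  toLinfty (∑ k ∈ E, fCoeff (f : Torus d → ℂ) k • trigChar k)

/-- Kolmogorov numbers. -/
noncomputable def dK {A B : Type*} [Norm A] [NormedAddCommGroup B] [NormedSpace ℂ B]
    (T : A → B) (m : ℕ) : ℝ :=
  ⨅ L : {L : Submodule ℂ B // FiniteDimensional ℂ L ∧ Module.finrank ℂ L < m},
    ⨆ a : {a : A // ‖a‖ ≤ 1}, ⨅ b : L.1, ‖T a.1 - (b : B)‖

/-- The real sign attached to a Boolean. -/
def boolSign (b : Bool) : ℝ := if b then 1 else -1

/-- The signed sum `∑ ± a i`. -/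
def signSum {n : ℕ} (a : Fin n → ℝ) (s : Fin n → Bool) : ℝ := ∑ i, boolSign (s i) * a i

lemma sum_signs_succ {n : ℕ} (a : Fin (n + 1) → ℝ) (F : ℝ → ℝ) :
    ∑ s, F (signSum a s) =
      ∑ s, F (a 0 + signSum (fun i => a i.succ) s) +
        ∑ s, F (-a 0 + signSum (fun i => a i.succ) s) := by
  rw [← (Fin.consEquiv fun _ : Fin (n + 1) => Bool).sum_comp, Fintype.sum_prod_type,
    Fintype.sum_bool]
  simp [signSum, boolSign, Fin.sum_univ_succ, Fin.consEquiv]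

lemma sum_signs_sq {n : ℕ} (a : Fin n → ℝ) (x : ℝ) :
    ∑ s, (x + signSum a s) ^ 2 = 2 ^ n * (x ^ 2 + ∑ i, a i ^ 2) := by
  induction n generalizing x with
  | zero => simp [signSum]
  | succ n ih =>
    rw [sum_signs_succ a fun z => (x + z) ^ 2]
    simp only [← add_assoc]
    rw [ih, ih, Fin.sum_univ_succ]
    ring

lemma sum_signs_pow_four_le {n : ℕ} (a : Fin n → ℝ) (x : ℝ) :
    ∑ s, (x + signSum a s) ^ 4 ≤
      2 ^ n * (x ^ 4 + 6 * x ^ 2 * ∑ i, a i ^ 2 + 3 * (∑ i, a i ^ 2) ^ 2) := by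
  induction n generalizing x with
  | zero => simp [signSum]
  | succ n ih =>
    rw [sum_signs_succ a fun z => (x + z) ^ 4]
    simp only [← add_assoc]
    refine (add_le_add (ih _ _) (ih _ _)).trans ?_
    rw [Fin.sum_univ_succ, ← mul_add ((2 : ℝ) ^ n), pow_succ (2 : ℝ) n, mul_assoc ((2 : ℝ) ^ n)]
    refine mul_le_mul_of_nonneg_left ?_ (by positivity)
    nlinarith [pow_nonneg (sq_nonneg (a 0)) 2]

lemma sum_signs_exp_sq_le {n : ℕ} (a : Fin n → ℝ) (x θ : ℝ) (h : 2 * ∑ i, a i ^ 2 < θ) :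
    ∑ s, exp ((x + signSum a s) ^ 2 / θ) ≤
      2 ^ n * exp ((x ^ 2 + ∑ i, a i ^ 2) / (θ - 2 * ∑ i, a i ^ 2)) := by
  induction n generalizing x with
  | zero => simp [signSum]
  | succ n ih =>
    rw [sum_signs_succ a fun z => exp ((x + z) ^ 2 / θ)]
    simp only [← add_assoc]
    rw [Fin.sum_univ_succ] at h ⊢
    set A := ∑ i : Fin n, a i.succ ^ 2
    set b := a 0
    have hA : 2 * A < θ := by nlinarith [sq_nonneg b]
    refine (add_le_add (ih _ _ hA) (ih _ _ hA)).trans ?_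
    rw [← mul_add, pow_succ (2 : ℝ) n, mul_assoc]
    refine mul_le_mul_of_nonneg_left ?_ (by positivity)
    set η := θ - 2 * A with hη
    have hη0 : 0 < η := by linarith
    have hη1 : 0 < η - 2 * b ^ 2 := by linarith
    have e : θ - 2 * (b ^ 2 + A) = η - 2 * b ^ 2 := by rw [hη]; ring
    have e1 : ((x + b) ^ 2 + A) / η = (x ^ 2 + b ^ 2 + A) / η + 2 * x * b / η := by ring
    have e2 : ((x + -b) ^ 2 + A) / η = (x ^ 2 + b ^ 2 + A) / η + -(2 * x * b / η) := by ring
    rw [e, e1, e2, exp_add, exp_add, ← mul_add]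
    have hc : exp (2 * x * b / η) + exp (-(2 * x * b / η)) ≤ 2 * exp ((2 * x * b / η) ^ 2 / 2) := by
      have := Real.cosh_le_exp_half_sq (2 * x * b / η)
      rw [Real.cosh_eq] at this
      linarith
    refine (mul_le_mul_of_nonneg_left hc (exp_pos _).le).trans ?_
    rw [mul_left_comm, ← exp_add]
    refine mul_le_mul_of_nonneg_left (exp_le_exp.2 ?_) (by norm_num)
    have hA0 : 0 ≤ A := Finset.sum_nonneg fun i _ => sq_nonneg _
    have k1 : (b ^ 2 + A) / η ≤ (b ^ 2 + A) / (η - 2 * b ^ 2) :=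
      div_le_div_of_nonneg_left (by positivity) hη1 (by nlinarith [sq_nonneg b])
    have k2 : x ^ 2 / η + (2 * x * b / η) ^ 2 / 2 ≤ x ^ 2 / (η - 2 * b ^ 2) := by
      rw [le_div_iff₀ hη1]
      have : (x ^ 2 / η + (2 * x * b / η) ^ 2 / 2) * (η - 2 * b ^ 2)
          = x ^ 2 * (1 - (2 * b ^ 2 / η) ^ 2) := by field_simp; ring
      rw [this]
      nlinarith [mul_nonneg (sq_nonneg x) (sq_nonneg (2 * b ^ 2 / η))]
    calc (x ^ 2 + b ^ 2 + A) / η + (2 * x * b / η) ^ 2 / 2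
        = (b ^ 2 + A) / η + (x ^ 2 / η + (2 * x * b / η) ^ 2 / 2) := by ring
      _ ≤ (b ^ 2 + A) / (η - 2 * b ^ 2) + x ^ 2 / (η - 2 * b ^ 2) := add_le_add k1 k2
      _ = _ := by ring

/-- The signed sum `∑ ± v i` of complex numbers. -/
def signSumC {n : ℕ} (v : Fin n → ℂ) (s : Fin n → Bool) : ℂ := ∑ i, (boolSign (s i) : ℂ) * v i

lemma norm_sq_signSumC {n : ℕ} (v : Fin n → ℂ) (s : Fin n → Bool) :
    ‖signSumC v s‖ ^ 2 =
      signSum (fun i => (v i).re) s ^ 2 + signSum (fun i => (v i).im) s ^ 2 := by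
  rw [Complex.sq_norm, Complex.normSq_apply]
  simp [signSumC, signSum, sq]

lemma sum_norm_sq_eq {n : ℕ} (v : Fin n → ℂ) :
    ∑ i, ‖v i‖ ^ 2 = ∑ i, (v i).re ^ 2 + ∑ i, (v i).im ^ 2 := by
  rw [← Finset.sum_add_distrib]
  exact Finset.sum_congr rfl fun i _ => by rw [Complex.sq_norm, Complex.normSq_apply]; ring

lemma exp_neg_le {x : ℝ} (hx : 0 ≤ x) : exp (-x) ≤ 1 - x + x ^ 2 / 2 := by
  have h := Real.quadratic_le_exp_of_nonneg hx
  rw [exp_neg, inv_le_comm₀ (exp_pos _) (by nlinarith [sq_nonneg (x - 1)])]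
  refine le_trans ?_ h
  rw [inv_le_iff_one_le_mul₀ (by nlinarith [sq_nonneg (x - 1)])]
  nlinarith [pow_nonneg hx 4]

lemma sum_signs_exp_neg_le {n : ℕ} (v : Fin n → ℂ) (hv : 0 < ∑ i, ‖v i‖ ^ 2) :
    ∑ s, exp (1 / 24 - ‖signSumC v s‖ ^ 2 / (6 * ∑ i, ‖v i‖ ^ 2)) ≤ 22 / 23 * 2 ^ n := by
  set A := ∑ i, ‖v i‖ ^ 2 with hA
  have hA' := sum_norm_sq_eq v
  rw [← hA] at hA'
  set B := ∑ i, (v i).re ^ 2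
  set D := ∑ i, (v i).im ^ 2
  have hB : 0 ≤ B := Finset.sum_nonneg fun i _ => sq_nonneg _
  have hD : 0 ≤ D := Finset.sum_nonneg fun i _ => sq_nonneg _
  have r2 := sum_signs_sq (fun i => (v i).re) 0
  have i2 := sum_signs_sq (fun i => (v i).im) 0
  have r4 := sum_signs_pow_four_le (fun i => (v i).re) 0
  have i4 := sum_signs_pow_four_le (fun i => (v i).im) 0
  simp only [zero_add, ne_eq, OfNat.ofNat_ne_zero, not_false_eq_true, zero_pow, mul_zero,
    zero_mul] at r2 i2 r4 i4
  have h24 : exp (1 / 24 : ℝ) ≤ 24 / 23 := by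
    have := Real.add_one_le_exp (-(1 / 24) : ℝ)
    rw [exp_neg, le_inv_comm₀ (by norm_num) (exp_pos _)] at this
    norm_num at this ⊢
    exact this
  have pt : ∀ s, exp (1 / 24 - ‖signSumC v s‖ ^ 2 / (6 * A)) ≤
      24 / 23 * (1 - (signSum (fun i => (v i).re) s ^ 2 + signSum (fun i => (v i).im) s ^ 2) / (6 * A)
        + (signSum (fun i => (v i).re) s ^ 4 + signSum (fun i => (v i).im) s ^ 4)
          / (36 * A ^ 2)) := by
    intro s
    rw [norm_sq_signSumC, sub_eq_add_neg, exp_add]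
    set p := signSum (fun i => (v i).re) s
    set q := signSum (fun i => (v i).im) s
    refine mul_le_mul h24 ((exp_neg_le (by positivity)).trans ?_) (exp_pos _).le (by norm_num)
    have : ((p ^ 2 + q ^ 2) / (6 * A)) ^ 2 / 2 ≤ (p ^ 4 + q ^ 4) / (36 * A ^ 2) := by
      rw [div_pow, mul_pow, div_div, div_le_div_iff₀ (by positivity) (by positivity)]
      nlinarith [mul_nonneg (sq_nonneg A) (sq_nonneg (p ^ 2 - q ^ 2))]
    linarith
  refine (Finset.sum_le_sum fun s _ => pt s).trans ?_
  rw [← Finset.mul_sum, Finset.sum_add_distrib, Finset.sum_sub_distrib, ← Finset.sum_div,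
    ← Finset.sum_div, Finset.sum_add_distrib, Finset.sum_add_distrib, r2, i2]
  have c : ∑ _s : Fin n → Bool, (1 : ℝ) = 2 ^ n := by simp
  rw [c, ← mul_add, ← hA']
  have f4 : (∑ s, signSum (fun i => (v i).re) s ^ 4 + ∑ s, signSum (fun i => (v i).im) s ^ 4)
      / (36 * A ^ 2) ≤ 2 ^ n * (1 / 12) := by
    rw [div_le_iff₀ (by positivity)]
    have : (2 : ℝ) ^ n * (3 * B ^ 2) + 2 ^ n * (3 * D ^ 2) ≤ 2 ^ n * (3 * A ^ 2) := by
      rw [← mul_add]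
      refine mul_le_mul_of_nonneg_left ?_ (by positivity)
      rw [hA']
      nlinarith [mul_nonneg hB hD]
    linarith
  have f2 : (2 : ℝ) ^ n * A / (6 * A) = 2 ^ n / 6 := by field_simp
  rw [f2]
  linarith

lemma sum_signs_exp_le {n : ℕ} (v : Fin n → ℂ) {M : ℝ} (hM : 0 < M) (hv : ∑ i, ‖v i‖ ^ 2 ≤ M) :
    ∑ s, exp (‖signSumC v s‖ ^ 2 / (8 * M) - 1) ≤ 22 / 23 * 2 ^ n := by
  have hA' := sum_norm_sq_eq v
  have key : ∀ a : Fin n → ℝ, ∑ i, a i ^ 2 ≤ M →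
      ∑ s, exp (signSum a s ^ 2 / (4 * M)) ≤ 2 ^ n * exp (1 / 2) := by
    intro a ha
    have := sum_signs_exp_sq_le a 0 (4 * M) (by linarith)
    simp only [zero_add] at this
    refine this.trans (mul_le_mul_of_nonneg_left (exp_le_exp.2 ?_) (by positivity))
    rw [div_le_div_iff₀ (by linarith) (by norm_num)]
    simp
    linarith
  have hB : 0 ≤ ∑ i, (v i).re ^ 2 := Finset.sum_nonneg fun i _ => sq_nonneg _
  have hD : 0 ≤ ∑ i, (v i).im ^ 2 := Finset.sum_nonneg fun i _ => sq_nonneg _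
  have k1 := key (fun i => (v i).re) (by linarith)
  have k2 := key (fun i => (v i).im) (by linarith)
  have pt : ∀ s, exp (‖signSumC v s‖ ^ 2 / (8 * M) - 1) ≤
      exp (-1) * ((exp (signSum (fun i => (v i).re) s ^ 2 / (4 * M)) +
        exp (signSum (fun i => (v i).im) s ^ 2 / (4 * M))) / 2) := by
    intro s
    rw [norm_sq_signSumC, sub_eq_neg_add, exp_add]
    refine mul_le_mul_of_nonneg_left ?_ (exp_pos _).le
    set p := signSum (fun i => (v i).re) s
    set q := signSum (fun i => (v i).im) s
    have e : (p ^ 2 + q ^ 2) / (8 * M) = p ^ 2 / (4 * M) / 2 + q ^ 2 / (4 * M) / 2 := by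
      field_simp; ring
    rw [e, exp_add]
    have e1 : exp (p ^ 2 / (4 * M)) = exp (p ^ 2 / (4 * M) / 2) ^ 2 := by
      rw [← exp_nat_mul]; congr 1; push_cast; ring
    have e2 : exp (q ^ 2 / (4 * M)) = exp (q ^ 2 / (4 * M) / 2) ^ 2 := by
      rw [← exp_nat_mul]; congr 1; push_cast; ring
    rw [e1, e2]
    nlinarith [sq_nonneg (exp (p ^ 2 / (4 * M) / 2) - exp (q ^ 2 / (4 * M) / 2))]
  refine (Finset.sum_le_sum fun s _ => pt s).trans ?_
  rw [← Finset.mul_sum, ← Finset.sum_div, Finset.sum_add_distrib]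
  calc _ ≤ exp (-1) * ((2 ^ n * exp (1 / 2) + 2 ^ n * exp (1 / 2)) / 2) := by gcongr
    _ = exp (-(1 / 2)) * 2 ^ n := by
      rw [show (-(1 / 2) : ℝ) = -1 + 1 / 2 by norm_num, exp_add]; ring
    _ ≤ _ := by
      refine mul_le_mul_of_nonneg_right ?_ (by positivity)
      have := Real.add_one_le_exp (1 / 2 : ℝ)
      rw [exp_neg, inv_le_comm₀ (exp_pos _) (by norm_num)]
      refine le_trans ?_ this
      norm_num

lemma exists_prod_sum_le {Ω β : Type*} [Fintype Ω] [Nonempty Ω] (B : Finset β)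
    (g : β → Ω → ℝ) (ρ : ℝ) (hg : ∀ b ω, 0 ≤ g b ω)
    (h : ∀ b ∈ B, ∑ ω, g b ω ≤ ρ * Fintype.card Ω) (m : ℕ) :
    ∃ p : Fin m → Ω, ∑ b ∈ B, ∏ j, g b (p j) ≤ B.card * ρ ^ m := by
  obtain ⟨p, -, hp⟩ := Finset.exists_le_of_sum_le (s := (Finset.univ : Finset (Fin m → Ω)))
    (f := fun p => ∑ b ∈ B, ∏ j, g b (p j)) (g := fun _ => B.card * ρ ^ m)
    Finset.univ_nonempty (by
      rw [Finset.sum_comm]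
      calc ∑ b ∈ B, ∑ p : Fin m → Ω, ∏ j, g b (p j) = ∑ b ∈ B, (∑ ω, g b ω) ^ m :=
            Finset.sum_congr rfl fun b _ => (Fintype.sum_pow _ _).symm
        _ ≤ ∑ b ∈ B, (ρ * Fintype.card Ω) ^ m := Finset.sum_le_sum fun b hb =>
            pow_le_pow_left₀ (Finset.sum_nonneg fun ω _ => hg b ω) (h b hb) m
        _ = _ := by simp [mul_pow]; ring)
  exact ⟨p, hp⟩

/-- Sign matrices that are bounded from below on one finite family and from above on another. -/
lemma exists_sign_rows {n : ℕ} {β τ : Type*} [Fintype β] [Fintype τ] (y : β → Fin n → ℂ)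
    (v : τ → Fin n → ℂ) {M : ℝ} (hM : 0 < M) (hv : ∀ t, ∑ i, ‖v t i‖ ^ 2 ≤ M) (m : ℕ)
    (hm : ((Fintype.card β : ℝ) + Fintype.card τ) * (22 / 23) ^ m < 1) :
    ∃ p : Fin m → Fin n → Bool,
      (∀ b, m * (∑ i, ‖y b i‖ ^ 2) / 4 ≤ ∑ j, ‖signSumC (y b) (p j)‖ ^ 2) ∧
      ∀ t, ∑ j, ‖signSumC (v t) (p j)‖ ^ 2 ≤ 8 * M * m := by
  classical
  let g : β ⊕ τ → (Fin n → Bool) → ℝ := Sum.elim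
    (fun b s => exp (1 / 24 - ‖signSumC (y b) s‖ ^ 2 / (6 * ∑ i, ‖y b i‖ ^ 2)))
    (fun t s => exp (‖signSumC (v t) s‖ ^ 2 / (8 * M) - 1))
  let B : Finset (β ⊕ τ) :=
    (Finset.univ.filter fun b => 0 < ∑ i, ‖y b i‖ ^ 2).disjSum Finset.univ
  have hg : ∀ b s, 0 < g b s := by rintro (b | t) s <;> exact exp_pos _
  obtain ⟨p, hp⟩ := exists_prod_sum_le B g (22 / 23) (fun b s => (hg b s).le) (by
    rintro (b | t) hb
    · simp only [B, Finset.inl_mem_disjSum, Finset.mem_filter] at hb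
      simpa [g] using sum_signs_exp_neg_le (y b) hb.2
    · simpa [g] using sum_signs_exp_le (v t) hM (hv t)) m
  have hB : (B.card : ℝ) ≤ Fintype.card β + Fintype.card τ := by
    simp only [B, Finset.card_disjSum]
    push_cast
    gcongr
    · exact Finset.card_le_univ _
    · exact Finset.card_le_univ _
  have hlt : ∀ b ∈ B, ∏ j, g b (p j) < 1 := fun b hb => by
    have h1 := Finset.single_le_sum (f := fun b => ∏ j, g b (p j))
      (fun b _ => Finset.prod_nonneg fun j _ => (hg b (p j)).le) hb
    refine (h1.trans hp).trans_lt (lt_of_le_of_lt ?_ hm)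
    gcongr
  refine ⟨p, fun b => ?_, fun t => ?_⟩
  · rcases (Finset.sum_nonneg fun i _ => sq_nonneg ‖y b i‖).eq_or_lt with h0 | h0
    · rw [← h0]; simp only [mul_zero, zero_div]; positivity
    have := hlt (Sum.inl b) (by simp [B, h0])
    simp only [g, Sum.elim_inl] at this
    rw [← exp_sum, exp_lt_one_iff, Finset.sum_sub_distrib, Finset.sum_const,
      ← Finset.sum_div, Finset.card_univ, Fintype.card_fin, nsmul_eq_mul] at this
    have h2 : (m : ℝ) * (1 / 24) < (∑ j, ‖signSumC (y b) (p j)‖ ^ 2) / (6 * ∑ i, ‖y b i‖ ^ 2) := by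
      linarith
    rw [lt_div_iff₀ (by positivity)] at h2
    linarith
  · have := hlt (Sum.inr t) (by simp [B])
    simp only [g, Sum.elim_inr] at this
    rw [← exp_sum, exp_lt_one_iff, Finset.sum_sub_distrib, Finset.sum_const,
      ← Finset.sum_div, Finset.card_univ, Fintype.card_fin, nsmul_eq_mul] at this
    have h2 : (∑ j, ‖signSumC (v t) (p j)‖ ^ 2) / (8 * M) < m := by linarith
    rw [div_lt_iff₀ (by positivity)] at h2
    linarith

/-- The four numbers `±2, ±2i`. -/
def quarterPhase (a : Bool × Bool) : ℂ :=
  2 * (boolSign a.1 : ℂ) * (if a.2 then 1 else Complex.I)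

lemma norm_quarterPhase (a : Bool × Bool) : ‖quarterPhase a‖ = 2 := by
  rcases a with ⟨_ | _, _ | _⟩ <;> simp [quarterPhase, boolSign]

lemma exists_quarterPhase_re_le (z : ℂ) : ∃ a, (quarterPhase a * z).re ≤ -‖z‖ := by
  have h := Complex.norm_le_abs_re_add_abs_im z
  by_contra! hc
  have h1 := hc (true, true)
  have h2 := hc (false, true)
  have h3 := hc (true, false)
  have h4 := hc (false, false)
  simp [quarterPhase, boolSign] at h1 h2 h3 h4
  rcases abs_cases z.re with ⟨e, _⟩ | ⟨e, _⟩ <;> rcases abs_cases z.im with ⟨f, _⟩ | ⟨f, _⟩ <;>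
    linarith

/-- Maurey's empirical method for complex absolutely convex combinations. -/
lemma exists_empirical_approx {F τ : Type*} [NormedAddCommGroup F] [InnerProductSpace ℂ F]
    [Fintype τ] [Nonempty τ] (u : τ → F) {M : ℝ} (hu : ∀ t, ‖u t‖ ^ 2 ≤ M) (c : τ → ℂ)
    (hc : ∑ t, ‖c t‖ ≤ 1) (k : ℕ) :
    ∃ w : Fin k → τ × (Bool × Bool),
      ‖∑ j, quarterPhase (w j).2 • u (w j).1 - (k : ℂ) • ∑ t, c t • u t‖ ^ 2 ≤ k * (4 * M) := by
  set x := ∑ t, c t • u t with hx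
  induction k with
  | zero => exact ⟨Fin.elim0, by simp⟩
  | succ k ih =>
    obtain ⟨w, hw⟩ := ih
    set r := ∑ j, quarterPhase (w j).2 • u (w j).1 - (k : ℂ) • x with hr
    set q := r - x with hq
    obtain ⟨t₀, ht₀⟩ := Finite.exists_max fun t => ‖inner ℂ q (u t)‖
    obtain ⟨a, ha⟩ := exists_quarterPhase_re_le (inner ℂ q (u t₀))
    set s := quarterPhase a • u t₀ with hs
    have h1 : (inner ℂ q s).re ≤ (inner ℂ q x).re := by
      rw [hs, inner_smul_right]
      refine ha.trans ?_
      have : ‖inner ℂ q x‖ ≤ ‖inner ℂ q (u t₀)‖ := by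
        rw [hx, inner_sum]
        calc _ ≤ ∑ t, ‖c t‖ * ‖inner ℂ q (u t₀)‖ := by
              refine norm_sum_le_of_le _ fun t _ => ?_
              rw [inner_smul_right, norm_mul]
              exact mul_le_mul_of_nonneg_left (ht₀ t) (norm_nonneg _)
          _ ≤ _ := by
              rw [← Finset.sum_mul]
              exact mul_le_of_le_one_left (norm_nonneg _) hc
      have := (abs_le.1 (Complex.abs_re_le_norm (inner ℂ q x))).1
      linarith
    have hs2 : ‖s‖ ^ 2 ≤ 4 * M := by
      rw [hs, norm_smul, norm_quarterPhase, mul_pow]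
      linarith [hu t₀]
    refine ⟨Fin.snoc w (t₀, a), ?_⟩
    have e : ∑ j, quarterPhase ((Fin.snoc w (t₀, a) : Fin (k + 1) → τ × (Bool × Bool)) j).2 •
        u ((Fin.snoc w (t₀, a) : Fin (k + 1) → τ × (Bool × Bool)) j).1 - ((k + 1 : ℕ) : ℂ) • x
        = q + s := by
      rw [Fin.sum_univ_castSucc]
      simp only [Fin.snoc_castSucc, Fin.snoc_last, hq, hr, hs, Nat.cast_add, Nat.cast_one, add_smul,
        one_smul]
      abel
    rw [e]
    have er : ‖r‖ ^ 2 = ‖q‖ ^ 2 + 2 * (inner ℂ q x).re + ‖x‖ ^ 2 := by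
      have : r = q + x := by rw [hq]; abel
      rw [this, @norm_add_sq ℂ]; rfl
    have es : ‖q + s‖ ^ 2 = ‖q‖ ^ 2 + 2 * (inner ℂ q s).re + ‖s‖ ^ 2 := by
      rw [@norm_add_sq ℂ]; rfl
    push_cast
    nlinarith [sq_nonneg ‖x‖]

lemma signSumC_sum_smul {n : ℕ} {σ : Type*} (S : Finset σ) (c : σ → ℂ) (v : σ → Fin n → ℂ)
    (s : Fin n → Bool) :
    signSumC (fun i => ∑ t ∈ S, c t * v t i) s = ∑ t ∈ S, c t * signSumC (v t) s := by
  simp only [signSumC, Finset.mul_sum]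
  rw [Finset.sum_comm]
  exact Finset.sum_congr rfl fun t _ => Finset.sum_congr rfl fun i _ => by ring

/-- Gelfand-width estimate for the absolutely convex hull of finitely many vectors. -/
lemma exists_sign_rows_kernel_bound {n : ℕ} {τ : Type*} [Fintype τ] [Nonempty τ]
    (v : τ → Fin n → ℂ) {M : ℝ} (hM : 0 < M) (hv : ∀ t, ∑ i, ‖v t i‖ ^ 2 ≤ M) (m k : ℕ)
    (hm0 : 0 < m) (hk : 0 < k)
    (hm : k * Real.log (8 * Fintype.card τ) * 23 < m) :
    ∃ p : Fin m → Fin n → Bool, ∀ c : τ → ℂ, ∑ t, ‖c t‖ ≤ 1 →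
      (∀ j, ∑ t, c t * signSumC (v t) (p j) = 0) →
      ∑ i, ‖∑ t, c t * v t i‖ ^ 2 ≤ 288 * M / k := by
  have hN : (1 : ℝ) ≤ Fintype.card τ := by exact_mod_cast Fintype.card_pos
  let y : (Fin k → τ × (Bool × Bool)) → Fin n → ℂ :=
    fun w i => ∑ j, quarterPhase (w j).2 * v (w j).1 i
  obtain ⟨p, hp1, hp2⟩ := exists_sign_rows y v hM hv m (by
    set N : ℝ := (Fintype.card τ : ℝ)
    have hcard : (Fintype.card (Fin k → τ × (Bool × Bool)) : ℝ) = (N * 4) ^ k := by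
      simp [N]
    rw [hcard]
    have h1 : (N * 4) ^ k + N ≤ (8 * N) ^ k := by
      have h2 : N ≤ (N * 4) ^ k := (by linarith : N ≤ N * 4).trans (le_self_pow₀ (by linarith) hk.ne')
      have h3 : (2 : ℝ) ≤ 2 ^ k := le_self_pow₀ (by norm_num) hk.ne'
      calc (N * 4) ^ k + N ≤ 2 * (N * 4) ^ k := by linarith
        _ ≤ 2 ^ k * (N * 4) ^ k := by gcongr
        _ = _ := by rw [← mul_pow]; ring
    refine lt_of_le_of_lt (mul_le_mul_of_nonneg_right h1 (by positivity)) ?_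
    rw [← Real.log_neg_iff (by positivity), Real.log_mul (by positivity) (by positivity),
      Real.log_pow, Real.log_pow]
    have h4 : Real.log (22 / 23) ≤ -(1 / 23) := by
      have := Real.log_le_sub_one_of_pos (show (0 : ℝ) < 22 / 23 by norm_num)
      linarith
    have h5 : (m : ℝ) * Real.log (22 / 23) ≤ m * (-(1 / 23)) := by gcongr
    linarith)
  refine ⟨p, fun c hc hker => ?_⟩
  have hmR : (0 : ℝ) < m := by exact_mod_cast hm0
  have hkR : (0 : ℝ) < k := by exact_mod_cast hk
  let u : τ → EuclideanSpace ℂ (Fin n ⊕ Fin m) := fun t => WithLp.toLp 2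
    (Sum.elim (v t) fun j => ((√m : ℝ) : ℂ)⁻¹ * signSumC (v t) (p j))
  have hnorm : ∀ z : EuclideanSpace ℂ (Fin n ⊕ Fin m), ‖z‖ ^ 2 =
      ∑ i, ‖z (Sum.inl i)‖ ^ 2 + ∑ j, ‖z (Sum.inr j)‖ ^ 2 := fun z => by
    rw [EuclideanSpace.norm_sq_eq, Fintype.sum_sum_type]
  have hscale : ∀ z : ℂ, ‖((√m : ℝ) : ℂ)⁻¹ * z‖ ^ 2 = ‖z‖ ^ 2 / m := fun z => by
    rw [norm_mul, norm_inv, Complex.norm_real, Real.norm_of_nonneg (sqrt_nonneg _), mul_pow,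
      inv_pow, Real.sq_sqrt hmR.le]
    ring
  have hu : ∀ t, ‖u t‖ ^ 2 ≤ 9 * M := fun t => by
    rw [hnorm]
    simp only [u, Sum.elim_inl, Sum.elim_inr, hscale, ← Finset.sum_div]
    have : (∑ j, ‖signSumC (v t) (p j)‖ ^ 2) / m ≤ 8 * M := by
      rw [div_le_iff₀ hmR]; exact hp2 t
    linarith [hv t]
  obtain ⟨w, hw⟩ := exists_empirical_approx u hu c hc k
  rw [hnorm] at hw
  have e1 : ∀ i, (∑ j, quarterPhase (w j).2 • u (w j).1 - (k : ℂ) • ∑ t, c t • u t) (Sum.inl i)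
      = y w i - k * ∑ t, c t * v t i := fun i => by
    simp [u, y]
  have e2 : ∀ l, (∑ j, quarterPhase (w j).2 • u (w j).1 - (k : ℂ) • ∑ t, c t • u t) (Sum.inr l)
      = ((√m : ℝ) : ℂ)⁻¹ * signSumC (y w) (p l) := fun l => by
    have h0 : ∑ t, c t * (((√m : ℝ) : ℂ)⁻¹ * signSumC (v t) (p l)) = 0 := by
      rw [← mul_zero ((√m : ℝ) : ℂ)⁻¹, ← hker l, Finset.mul_sum]
      exact Finset.sum_congr rfl fun t _ => by ring
    have h1 : signSumC (y w) (p l) = ∑ j, quarterPhase (w j).2 * signSumC (v (w j).1) (p l) :=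
      signSumC_sum_smul _ _ (fun j => v (w j).1) _
    rw [h1, Finset.mul_sum]
    simp [u, h0, mul_left_comm]
  simp only [e1, e2, hscale, ← Finset.sum_div] at hw
  have h3 : (∑ i, ‖y w i‖ ^ 2) / 4 ≤ (∑ j, ‖signSumC (y w) (p j)‖ ^ 2) / m := by
    rw [le_div_iff₀ hmR]
    linarith [hp1 w]
  have h4 : (k : ℝ) ^ 2 * ∑ i, ‖∑ t, c t * v t i‖ ^ 2 ≤
      2 * ∑ i, ‖y w i‖ ^ 2 + 2 * ∑ i, ‖y w i - k * ∑ t, c t * v t i‖ ^ 2 := by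
    rw [Finset.mul_sum, Finset.mul_sum, Finset.mul_sum, ← Finset.sum_add_distrib]
    refine Finset.sum_le_sum fun i _ => ?_
    have : ‖(k : ℂ) * ∑ t, c t * v t i‖ ≤ ‖y w i‖ + ‖y w i - k * ∑ t, c t * v t i‖ := by
      refine le_trans (le_of_eq ?_) (norm_sub_le _ _)
      congr 1; ring
    rw [norm_mul, Complex.norm_natCast] at this
    rw [← mul_pow]
    refine (pow_le_pow_left₀ (by positivity) this 2).trans ?_
    nlinarith [sq_nonneg (‖y w i‖ - ‖y w i - k * ∑ t, c t * v t i‖)]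
  have h5 : 0 ≤ ∑ i, ‖y w i - k * ∑ t, c t * v t i‖ ^ 2 := by positivity
  rw [le_div_iff₀ hkR]
  refine le_of_mul_le_mul_left ?_ hkR
  nlinarith

lemma exists_close_of_annihilator {τ : Type*} [Fintype τ] (W : Submodule ℂ (τ → ℂ)) (g : τ → ℂ)
    {D : ℝ} (h : ∀ c : τ → ℂ, ∑ t, ‖c t‖ ≤ 1 → (∀ w ∈ W, ∑ t, c t * w t = 0) →
      ‖∑ t, c t * g t‖ < D) :
    ∃ w ∈ W, ∀ t, ‖g t - w t‖ < D := by
  classical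
  have : IsClosed (W : Set (τ → ℂ)) := W.closed_of_finiteDimensional
  obtain ⟨f, hf1, hf2⟩ := exists_dual_vector'' ℂ (W.mkQ g)
  set φ : (τ → ℂ) →ₗ[ℂ] ℂ := f.toLinearMap ∘ₗ W.mkQ with hφ
  have hφn : ∀ z : τ → ℂ, ‖φ z‖ ≤ ‖z‖ := fun z => by
    refine (f.le_opNorm _).trans ?_
    refine (mul_le_of_le_one_left (norm_nonneg _) hf1).trans ?_
    exact Submodule.Quotient.norm_mk_le W z
  have hφc : ∀ z : τ → ℂ, φ z = ∑ t, φ (Pi.single t 1) * z t := fun z => by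
    conv_lhs => rw [LinearMap.pi_apply_eq_sum_univ φ z]
    refine Finset.sum_congr rfl fun t _ => ?_
    rw [smul_eq_mul, mul_comm]
    congr 2
    ext i
    simp [Pi.single_apply, eq_comm]
  have hsum : ∑ t, ‖φ (Pi.single t 1)‖ ≤ 1 := by
    have h1 := hφn fun t => conj (φ (Pi.single t 1)) / ‖φ (Pi.single t 1)‖
    rw [hφc] at h1
    have h2 : ∑ t, φ (Pi.single t 1) * (conj (φ (Pi.single t 1)) / ‖φ (Pi.single t 1)‖)
        = ((∑ t, ‖φ (Pi.single t 1)‖ : ℝ) : ℂ) := by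
      push_cast
      refine Finset.sum_congr rfl fun t _ => ?_
      rw [← mul_div_assoc, Complex.mul_conj, Complex.normSq_eq_norm_sq]
      by_cases h0 : ‖φ (Pi.single t 1)‖ = 0
      · simp [h0]
      · have : (‖φ (Pi.single t 1)‖ : ℂ) ≠ 0 := by exact_mod_cast h0
        field_simp
        push_cast
        ring
    rw [h2, Complex.norm_real, Real.norm_of_nonneg (by positivity)] at h1
    refine h1.trans ((pi_norm_le_iff_of_nonneg zero_le_one).2 fun t => ?_)
    simp only [norm_div, RCLike.norm_conj, Complex.norm_real, norm_norm]
    exact div_self_le_one _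
  have hD := h (fun t => φ (Pi.single t 1)) hsum fun w hw => by
    rw [← hφc, hφ]
    simp [(Submodule.Quotient.mk_eq_zero W).2 hw]
  rw [← hφc] at hD
  have hD' : ‖W.mkQ g‖ < D := by
    have : φ g = (‖W.mkQ g‖ : ℂ) := hf2
    rwa [this, Complex.norm_real, norm_norm] at hD
  obtain ⟨z, hz, hzn⟩ := Submodule.Quotient.norm_mk_lt (S := W) (W.mkQ g)
    (sub_pos.2 hD')
  refine ⟨g - z, ?_, fun t => ?_⟩
  · rw [← Submodule.Quotient.mk_eq_zero W, Submodule.Quotient.mk_sub, hz]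
    simp
  · have := norm_le_pi_norm z t
    simp only [Pi.sub_apply, sub_sub_cancel]
    linarith

lemma integral_conj_fourier_mul_fourier (a b : ℤ) :
    ∫ x : AddCircle (2 * π), conj (fourier a x) * fourier b x =
      if a = b then ((2 * π : ℝ) : ℂ) else 0 := by
  have h := orthonormal_iff_ite.1 (orthonormal_fourier (T := 2 * π)) a b
  simp only [fourierLp] at h
  rw [ContinuousMap.inner_toLp] at h
  rw [AddCircle.volume_eq_smul_haarAddCircle, integral_smul_measure,
    ENNReal.toReal_ofReal (by positivity)]
  simp only [mul_comm (conj _)]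
  rw [h]
  split_ifs <;> simp

lemma integral_conj_trigChar_mul_trigChar {d : ℕ} (k l : Fin d → ℤ) :
    ∫ x : Torus d, conj (trigChar k x) * trigChar l x =
      if k = l then (((2 * π) ^ d : ℝ) : ℂ) else 0 := by
  have h : ∀ x : Torus d, conj (trigChar k x) * trigChar l x =
      ∏ j, conj (fourier (k j) (x j)) * fourier (l j) (x j) := fun x => by
    simp [trigChar, Finset.prod_mul_distrib]
  simp only [h]
  rw [integral_fintype_prod_volume_eq_prod
    fun j (y : AddCircle (2 * π)) => conj (fourier (k j) y) * fourier (l j) y]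
  simp only [integral_conj_fourier_mul_fourier]
  split_ifs with hkl
  · subst hkl; simp
  · obtain ⟨j, hj⟩ := Function.ne_iff.1 hkl
    exact Finset.prod_eq_zero (Finset.mem_univ j) (if_neg hj)

lemma norm_trigChar_apply {d : ℕ} (k : Fin d → ℤ) (x : Torus d) : ‖trigChar k x‖ = 1 := by
  simp only [trigChar, ContinuousMap.coe_mk, norm_prod, fourier_apply, Circle.norm_coe,
    Finset.prod_const_one]

/-- Bessel's inequality for the Fourier coefficients. -/
lemma sum_norm_fCoeff_sq_le {d : ℕ} (E : Finset (Fin d → ℤ))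
    (f : Lp ℂ 2 (volume : Measure (Torus d))) :
    ∑ k ∈ E, ‖fCoeff (f : Torus d → ℂ) k‖ ^ 2 ≤ ((2 * π) ^ d)⁻¹ * ‖f‖ ^ 2 := by
  set V : ℝ := (2 * π) ^ d with hV
  have hV0 : 0 < V := by positivity
  set r : ℂ := (√V : ℂ)⁻¹ with hr
  have hrr : r * r = ((V⁻¹ : ℝ) : ℂ) := by
    rw [hr, ← mul_inv, ← Complex.ofReal_mul, Real.mul_self_sqrt hV0.le, Complex.ofReal_inv]
  have hrc : conj r = r := by simp [hr]
  let e : (Fin d → ℤ) → Lp ℂ 2 (volume : Measure (Torus d)) := fun k =>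
    r • ContinuousMap.toLp 2 (volume : Measure (Torus d)) ℂ (trigChar k)
  have he : Orthonormal ℂ e := by
    rw [orthonormal_iff_ite]
    intro k l
    simp only [e, inner_smul_left, inner_smul_right, ContinuousMap.inner_toLp, hrc]
    simp only [mul_comm _ (conj _)]
    rw [integral_conj_trigChar_mul_trigChar, ← mul_assoc, hrr]
    split_ifs
    · rw [← Complex.ofReal_mul, inv_mul_cancel₀ hV0.ne', Complex.ofReal_one]
    · simp
  have hin : ∀ k, fCoeff (f : Torus d → ℂ) k = r * inner ℂ (e k) f := fun k => by
    simp only [e, inner_smul_left, hrc]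
    rw [← mul_assoc, hrr, fCoeff, Complex.real_smul, L2.inner_def]
    congr 1
    refine integral_congr_ae ?_
    filter_upwards [ContinuousMap.coeFn_toLp (p := 2) (𝕜 := ℂ) (volume : Measure (Torus d))
      (trigChar k)] with x hx
    rw [hx]
    simp [mul_comm]
  have hb := he.sum_inner_products_le f (s := E)
  have hr2 : ‖r‖ ^ 2 = V⁻¹ := by
    rw [sq, ← norm_mul, hrr, Complex.norm_real, Real.norm_of_nonneg (by positivity)]
  simp only [hin, norm_mul, mul_pow, hr2]
  rw [← Finset.mul_sum]
  gcongr

/-- The coefficients of a trigonometric polynomial are bounded by its maximum. -/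
lemma norm_coeff_le_norm {d : ℕ} (E : Finset (Fin d → ℤ)) (a : (Fin d → ℤ) → ℂ)
    {k : Fin d → ℤ} (hk : k ∈ E) : ‖a k‖ ≤ ‖∑ l ∈ E, a l • trigChar l‖ := by
  set g := ∑ l ∈ E, a l • trigChar l with hg
  set V : ℝ := (2 * π) ^ d with hV
  have hV0 : 0 < V := by positivity
  have h1 : ∫ x : Torus d, conj (trigChar k x) * g x = V * a k := by
    have : ∀ x, conj (trigChar k x) * g x = ∑ l ∈ E, a l * (conj (trigChar k x) * trigChar l x) := by
      intro x
      simp only [hg, ContinuousMap.coe_sum, Finset.sum_apply, ContinuousMap.coe_smul, Pi.smul_apply,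
        smul_eq_mul, Finset.mul_sum]
      exact Finset.sum_congr rfl fun l _ => by ring
    simp only [this]
    rw [integral_finsetSum]
    · simp only [integral_const_mul, integral_conj_trigChar_mul_trigChar]
      simp [hk, hV, mul_comm]
    · intro l _
      have hc : Continuous fun x : Torus d => a l * (conj (trigChar k x) * trigChar l x) := by
        fun_prop
      exact hc.integrable_of_hasCompactSupport (HasCompactSupport.of_compactSpace _)
  have hvol : (volume : Measure (Torus d)).real Set.univ = V := by
    simp [Measure.real, volume_pi, Measure.pi_univ, hV, Real.pi_nonneg]
  have h2 := norm_integral_le_of_norm_le_const (μ := (volume : Measure (Torus d)))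
    (f := fun x => conj (trigChar k x) * g x) (C := ‖g‖) (Filter.Eventually.of_forall fun x => by
      rw [norm_mul, RCLike.norm_conj, norm_trigChar_apply, one_mul]
      exact g.norm_coe_le_norm x)
  rw [h1, hvol, norm_mul, Complex.norm_real, Real.norm_of_nonneg hV0.le, mul_comm] at h2
  exact le_of_mul_le_mul_right h2 hV0

lemma norm_toLinfty_le {d : ℕ} (g : C(Torus d, ℂ)) : ‖toLinfty g‖ ≤ ‖g‖ := by
  have h := Lp.norm_le_of_ae_bound (f := toLinfty g) (norm_nonneg g) (by
    filter_upwards [ContinuousMap.coeFn_toLp (p := ∞) (𝕜 := ℂ) (volume : Measure (Torus d)) g]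
      with x hx
    rw [toLinfty, hx]
    exact g.norm_coe_le_norm x)
  simpa using h

/-- A point of the uniform grid with `Q ^ d` points on the torus. -/
def gridPt {d Q : ℕ} (q : Fin d → Fin Q) : Torus d :=
  fun j => ((2 * π * (q j : ℕ) / Q : ℝ) : AddCircle (2 * π))

lemma trigChar_coe {d : ℕ} (k : Fin d → ℤ) (ξ : Fin d → ℝ) :
    trigChar k (fun j => (ξ j : AddCircle (2 * π))) =
      Complex.exp (Complex.I * ((∑ j, k j * ξ j : ℝ) : ℂ)) := by
  simp only [trigChar, ContinuousMap.coe_mk, fourier_coe_apply]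
  rw [← Complex.exp_sum]
  congr 1
  push_cast
  rw [Finset.mul_sum]
  refine Finset.sum_congr rfl fun j _ => ?_
  have : (π : ℂ) ≠ 0 := by exact_mod_cast Real.pi_ne_zero
  field_simp

lemma exists_gridPt_near {d Q : ℕ} (hQ : 0 < Q) (x : Torus d) :
    ∃ q : Fin d → Fin Q, ∀ (R : ℝ) (k : Fin d → ℤ), (∀ j, |(k j : ℝ)| ≤ R) →
      ‖trigChar k x - trigChar k (gridPt q)‖ ≤ d * R * (2 * π / Q) := by
  have hQ' : (0 : ℝ) < Q := by exact_mod_cast hQ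
  have hx : ∀ j, ∃ ξ : ℝ, ξ ∈ Set.Ico 0 (2 * π) ∧ (ξ : AddCircle (2 * π)) = x j := fun j => by
    have := (AddCircle.coe_image_Ico_eq (2 * π) 0).ge (Set.mem_univ (x j))
    simpa using this
  choose ξ hξ hξx using hx
  have hq : ∀ j, ∃ i : Fin Q, |ξ j - 2 * π * (i : ℕ) / Q| ≤ 2 * π / Q := fun j => by
    have h0 : 0 ≤ ξ j * Q / (2 * π) := by have := (hξ j).1; positivity
    have h1 : ξ j * Q / (2 * π) < Q := by
      rw [div_lt_iff₀ (by positivity)]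
      nlinarith [(hξ j).2]
    refine ⟨⟨⌊ξ j * Q / (2 * π)⌋₊, (Nat.floor_lt h0).2 h1⟩, ?_⟩
    have h2 := Nat.floor_le h0
    have h3 := Nat.lt_floor_add_one (ξ j * Q / (2 * π))
    have h4 : ξ j = 2 * π / Q * (ξ j * Q / (2 * π)) := by field_simp
    generalize ξ j * Q / (2 * π) = z at h0 h1 h2 h3 h4 ⊢
    simp only
    rw [h4, show 2 * π / Q * z - 2 * π * (⌊z⌋₊ : ℝ) / Q = 2 * π / Q * (z - ⌊z⌋₊) by ring,
      abs_mul, abs_of_pos (by positivity : 0 < 2 * π / (Q : ℝ))]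
    refine mul_le_of_le_one_right (by positivity) ?_
    rw [abs_le]
    constructor <;> linarith
  choose q hq using hq
  refine ⟨q, fun R k hk => ?_⟩
  have hxe : x = fun j => (ξ j : AddCircle (2 * π)) := funext fun j => (hξx j).symm
  rw [hxe]
  unfold gridPt
  rw [trigChar_coe, trigChar_coe k fun j => 2 * π * (q j : ℕ) / Q]
  set s := ∑ j, (k j : ℝ) * ξ j with hs
  set t := ∑ j, (k j : ℝ) * (2 * π * (q j : ℕ) / Q) with ht
  have e : Complex.exp (Complex.I * (s : ℂ)) - Complex.exp (Complex.I * (t : ℂ)) =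
      Complex.exp ((t : ℂ) * Complex.I) * (Complex.exp (Complex.I * ((s - t : ℝ) : ℂ)) - 1) := by
    rw [mul_sub, ← Complex.exp_add, mul_one]
    push_cast
    ring_nf
  rw [e, norm_mul, Complex.norm_exp_ofReal_mul_I, one_mul]
  refine norm_exp_I_mul_ofReal_sub_one_le.trans ?_
  rw [hs, ht, ← Finset.sum_sub_distrib]
  refine (norm_sum_le_of_le _ (f := fun j => _) (n := fun _ => R * (2 * π / Q)) fun j _ => ?_).trans ?_
  · rw [← mul_sub, norm_mul]
    exact mul_le_mul (hk j) (hq j) (norm_nonneg _) ((abs_nonneg _).trans (hk j))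
  · simp [mul_assoc]

/-- Discretization of the maximum norm of trigonometric polynomials. -/
lemma norm_trigPoly_le_of_grid {d Q : ℕ} (hQ : 0 < Q) (E : Finset (Fin d → ℤ)) {R : ℝ}
    (hE : ∀ k ∈ E, ∀ j, |(k j : ℝ)| ≤ R) (hQR : 2 * (E.card * (d * R * (2 * π / Q))) ≤ 1)
    (a : (Fin d → ℤ) → ℂ) {D : ℝ}
    (hD : ∀ q : Fin d → Fin Q, ‖∑ k ∈ E, a k * trigChar k (gridPt q)‖ ≤ D) :
    ‖∑ k ∈ E, a k • trigChar k‖ ≤ 2 * D := by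
  set g := ∑ k ∈ E, a k • trigChar k with hg
  have hgx : ∀ x, g x = ∑ k ∈ E, a k * trigChar k x := fun x => by simp [hg]
  have hD0 : 0 ≤ D := (norm_nonneg _).trans (hD fun _ => ⟨0, hQ⟩)
  have h : ‖g‖ ≤ D + ‖g‖ / 2 := by
    refine (ContinuousMap.norm_le _ (by positivity)).2 fun x => ?_
    obtain ⟨q, hq⟩ := exists_gridPt_near hQ x
    have e : g x = ∑ k ∈ E, a k * trigChar k (gridPt q) +
        ∑ k ∈ E, a k * (trigChar k x - trigChar k (gridPt q)) := by
      rw [hgx, ← Finset.sum_add_distrib]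
      exact Finset.sum_congr rfl fun k _ => by ring
    rw [e]
    refine (norm_add_le _ _).trans (add_le_add (hD q) ?_)
    refine (norm_sum_le_of_le E (n := fun _ => ‖g‖ * (d * R * (2 * π / Q))) fun k hk => ?_).trans ?_
    · rw [norm_mul]
      exact mul_le_mul (norm_coeff_le_norm E a hk) (hq R k (hE k hk)) (norm_nonneg _)
        (norm_nonneg _)
    · rw [Finset.sum_const, nsmul_eq_mul]
      nlinarith [norm_nonneg g]
  linarith

lemma dK_le {A B : Type*} [Norm A] [NormedAddCommGroup B] [NormedSpace ℂ B] (T : A → B) {m : ℕ}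
    (L : Submodule ℂ B) [FiniteDimensional ℂ L] (hL : Module.finrank ℂ L < m) {D : ℝ} (hD : 0 ≤ D)
    (h : ∀ a, ‖a‖ ≤ 1 → ∃ b ∈ L, ‖T a - b‖ ≤ D) : dK T m ≤ D := by
  refine (ciInf_le ⟨0, ?_⟩ (⟨L, inferInstance, hL⟩ :
    {L : Submodule ℂ B // FiniteDimensional ℂ L ∧ Module.finrank ℂ L < m})).trans ?_
  · rintro _ ⟨L, rfl⟩
    exact Real.iSup_nonneg fun a => Real.iInf_nonneg fun b => norm_nonneg _
  · refine Real.iSup_le (fun a => ?_) hD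
    obtain ⟨b, hb, hab⟩ := h a.1 a.2
    refine (ciInf_le ⟨0, ?_⟩ (⟨b, hb⟩ : L)).trans hab
    rintro _ ⟨b, rfl⟩
    exact norm_nonneg _

lemma sum_norm_fCoeff_sq_le_one {d : ℕ} (E : Finset (Fin d → ℤ))
    (f : Lp ℂ 2 (volume : Measure (Torus d))) (hf : ‖f‖ ≤ 1) :
    ∑ k ∈ E, ‖fCoeff (f : Torus d → ℂ) k‖ ^ 2 ≤ 1 := by
  refine (sum_norm_fCoeff_sq_le E f).trans ?_
  have h1 : (1 : ℝ) ≤ (2 * π) ^ d := one_le_pow₀ (by linarith [Real.two_le_pi])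
  exact mul_le_one₀ (inv_le_one_of_one_le₀ h1) (sq_nonneg _) (pow_le_one₀ (norm_nonneg _) hf)

lemma norm_sum_mul_le_sqrt {ι : Type*} (S : Finset ι) (a X : ι → ℂ) (ha : ∑ l ∈ S, ‖a l‖ ^ 2 ≤ 1) :
    ‖∑ l ∈ S, a l * X l‖ ≤ √(∑ l ∈ S, ‖X l‖ ^ 2) := by
  refine Real.le_sqrt_of_sq_le ?_
  have h1 : ‖∑ l ∈ S, a l * X l‖ ≤ ∑ l ∈ S, ‖a l‖ * ‖X l‖ :=
    norm_sum_le_of_le _ fun l _ => (norm_mul _ _).le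
  refine (pow_le_pow_left₀ (norm_nonneg _) h1 2).trans ?_
  refine (Finset.sum_mul_sq_le_sq_mul_sq _ _ _).trans ?_
  exact mul_le_of_le_one_left (Finset.sum_nonneg fun l _ => sq_nonneg _) ha

lemma norm_SE_le {d : ℕ} (E : Finset (Fin d → ℤ)) (f : Lp ℂ 2 (volume : Measure (Torus d)))
    (hf : ‖f‖ ≤ 1) : ‖SE d 2 E f‖ ≤ √E.card := by
  refine (norm_toLinfty_le _).trans ((ContinuousMap.norm_le _ (by positivity)).2 fun x => ?_)
  have := norm_sum_mul_le_sqrt E (fun k => fCoeff (f : Torus d → ℂ) k) (fun k => trigChar k x)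
    (sum_norm_fCoeff_sq_le_one E f hf)
  simpa [norm_trigChar_apply] using this

/-- Approximation of the Fourier projection from a random subspace of trigonometric polynomials
with signs as coefficients. -/
lemma exists_subspace_approx_SE {d Q : ℕ} (hQ : 0 < Q) (E : Finset (Fin d → ℤ)) (hEn : E.Nonempty)
    {R : ℝ} (hE : ∀ k ∈ E, ∀ j, |(k j : ℝ)| ≤ R)
    (hQR : 2 * (E.card * (d * R * (2 * π / Q))) ≤ 1) (m k : ℕ) (hm0 : 0 < m) (hk : 0 < k)
    (hm : k * Real.log (8 * (Q : ℝ) ^ d) * 23 < m) :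
    ∃ L : Submodule ℂ (Lp ℂ ∞ (volume : Measure (Torus d))), FiniteDimensional ℂ L ∧
      Module.finrank ℂ L ≤ m ∧ ∀ f : Lp ℂ 2 (volume : Measure (Torus d)), ‖f‖ ≤ 1 →
        ∃ b ∈ L, ‖SE d 2 E f - b‖ ≤ 4 * √(288 * E.card / k) := by
  have : Nonempty (Fin d → Fin Q) := ⟨fun _ => ⟨0, hQ⟩⟩
  have hn : (0 : ℝ) < E.card := by exact_mod_cast hEn.card_pos
  have hkR : (0 : ℝ) < k := by exact_mod_cast hk
  let e : Fin E.card ≃ E := E.equivFin.symm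
  have hsum : ∀ {M : Type} [AddCommMonoid M] (F : (Fin d → ℤ) → M),
      ∑ l ∈ E, F l = ∑ i, F (e i) := fun {M} _ F => by
    rw [e.sum_comp fun l : E => F l, Finset.sum_coe_sort]
  obtain ⟨p, hp⟩ := exists_sign_rows_kernel_bound
    (fun (q : Fin d → Fin Q) i => trigChar (e i : Fin d → ℤ) (gridPt q)) hn
    (fun q => by simp [norm_trigChar_apply]) m k hm0 hk (by simpa using hm)
  let σ : Fin m → (Fin d → ℤ) → ℂ := fun j l =>
    if h : l ∈ E then (boolSign (p j (e.symm ⟨l, h⟩)) : ℂ) else 0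
  have hσ : ∀ j i, σ j (e i) = boolSign (p j i) := fun j i => by simp [σ]
  let P : Fin m → C(Torus d, ℂ) := fun j => ∑ l ∈ E, σ j l • trigChar l
  have hP : ∀ j x, P j x = ∑ l ∈ E, σ j l * trigChar l x := fun j x => by simp [P]
  let w : Fin m → (Fin d → Fin Q) → ℂ := fun j q => P j (gridPt q)
  refine ⟨Submodule.span ℂ (Set.range fun j => toLinfty (P j)),
    FiniteDimensional.span_of_finite ℂ (Set.finite_range _),
    (finrank_range_le_card _).trans_eq (Fintype.card_fin m), fun f hf => ?_⟩
  set a : (Fin d → ℤ) → ℂ := fun l => fCoeff (f : Torus d → ℂ) l with ha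
  have hpos : 0 < √(288 * E.card / k) := Real.sqrt_pos.2 (by positivity)
  obtain ⟨u, hu, hgu⟩ := exists_close_of_annihilator (Submodule.span ℂ (Set.range w))
    (fun q => ∑ l ∈ E, a l * trigChar l (gridPt q)) (D := 2 * √(288 * E.card / k)) (by
      intro c hc hker
      have h1 := hp c hc fun j => by
        rw [← hker (w j) (Submodule.subset_span ⟨j, rfl⟩)]
        refine Finset.sum_congr rfl fun q _ => ?_
        simp only [w, hP, hsum, hσ, signSumC]
      rw [← hsum fun l => ‖∑ q, c q * trigChar l (gridPt q)‖ ^ 2] at h1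
      have h2 : ∑ q, c q * ∑ l ∈ E, a l * trigChar l (gridPt q) =
          ∑ l ∈ E, a l * ∑ q, c q * trigChar l (gridPt q) := by
        simp only [Finset.mul_sum]
        rw [Finset.sum_comm]
        exact Finset.sum_congr rfl fun l _ => Finset.sum_congr rfl fun q _ => by ring
      rw [h2]
      have h3 := (norm_sum_mul_le_sqrt E a _ (sum_norm_fCoeff_sq_le_one E f hf)).trans
        (Real.sqrt_le_sqrt h1)
      linarith)
  obtain ⟨γ, rfl⟩ := (Submodule.mem_span_range_iff_exists_fun ℂ).1 hu
  refine ⟨∑ j, γ j • toLinfty (P j),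
    (Submodule.mem_span_range_iff_exists_fun ℂ).2 ⟨γ, rfl⟩, ?_⟩
  have hb : SE d 2 E f - ∑ j, γ j • toLinfty (P j) =
      toLinfty (∑ l ∈ E, (a l - ∑ j, γ j * σ j l) • trigChar l) := by
    have h1 : ∑ l ∈ E, (a l - ∑ j, γ j * σ j l) • (trigChar l : C(Torus d, ℂ)) =
        ∑ l ∈ E, a l • trigChar l - ∑ j, γ j • P j := by
      simp only [sub_smul, Finset.sum_sub_distrib, Finset.sum_smul, P, Finset.smul_sum, mul_smul]
      rw [Finset.sum_comm (s := E)]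
    rw [h1]
    simp only [SE, toLinfty, map_sub, map_sum, map_smul, ha]
  rw [hb]
  refine (norm_toLinfty_le _).trans ((norm_trigPoly_le_of_grid hQ E hE hQR _
    (D := 2 * √(288 * E.card / k)) fun q => ?_).trans_eq (by ring))
  refine le_trans (le_of_eq ?_) (hgu q).le
  congr 1
  simp only [sub_mul, Finset.sum_sub_distrib, Finset.sum_mul, Finset.sum_apply, Pi.smul_apply,
    smul_eq_mul, w, hP, Finset.mul_sum, mul_assoc]
  rw [Finset.sum_comm (s := E)]

lemma card_le_of_abs_le {d : ℕ} (E : Finset (Fin d → ℤ)) {R : ℝ} (hR : 2 ≤ R)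
    (hE : ∀ k ∈ E, ∀ j, |(k j : ℝ)| ≤ R) : (E.card : ℝ) ≤ 3 ^ d * R ^ d := by
  have hsub : E ⊆ Fintype.piFinset fun _ : Fin d => Finset.Icc (-⌊R⌋) ⌊R⌋ := fun k hk => by
    rw [Fintype.mem_piFinset]
    intro j
    have := abs_le.1 (hE k hk j)
    rw [Finset.mem_Icc]
    refine ⟨?_, Int.le_floor.2 this.2⟩
    rw [neg_le]
    exact Int.le_floor.2 (by push_cast; linarith)
  have h0 : 0 ≤ ⌊R⌋ := Int.floor_nonneg.2 (by linarith)
  have h1 : ((⌊R⌋ + 1 - -⌊R⌋).toNat : ℝ) ≤ 3 * R := by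
    have : (((⌊R⌋ + 1 - -⌊R⌋).toNat : ℤ) : ℝ) = 2 * ⌊R⌋ + 1 := by
      rw [Int.toNat_of_nonneg (by omega)]; push_cast; ring
    have h2 := Int.floor_le R
    rw [← Int.cast_natCast, this]
    linarith
  calc (E.card : ℝ) ≤ ((⌊R⌋ + 1 - -⌊R⌋).toNat : ℝ) ^ d := by
        have := Finset.card_le_card hsub
        rw [Fintype.card_piFinset] at this
        simp only [Int.card_Icc, Finset.prod_const, Finset.card_univ, Fintype.card_fin] at this
        exact_mod_cast this
    _ ≤ (3 * R) ^ d := by gcongr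
    _ = _ := mul_pow _ _ _

/-- A grid of size polynomial in `R` suffices for frequencies bounded by `R`. -/
lemma exists_grid_size (d : ℕ) (hd : 1 ≤ d) :
    ∃ P : ℕ, 1 ≤ P ∧ ∀ R : ℝ, 2 ≤ R → ∀ E : Finset (Fin d → ℤ),
      (∀ k ∈ E, ∀ j, |(k j : ℝ)| ≤ R) → ∃ Q : ℕ, 0 < Q ∧
        2 * (E.card * (d * R * (2 * π / Q))) ≤ 1 ∧ Real.log (8 * (Q : ℝ) ^ d) ≤ P * Real.log R := by
  set K : ℝ := 4 * π * d * 3 ^ d with hK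
  have hd' : (0 : ℝ) < d := by exact_mod_cast hd
  have hK0 : 0 < K := by positivity
  obtain ⟨p, hp⟩ := pow_unbounded_of_one_lt (K + 1) (one_lt_two (α := ℝ))
  refine ⟨3 + (p + (d + 1)) * d, by omega, fun R hR E hE => ?_⟩
  have hR0 : 0 < R := by linarith
  have hKR : 0 < K * R ^ (d + 1) := by positivity
  have hQ0 : 0 < ⌈K * R ^ (d + 1)⌉₊ := Nat.ceil_pos.2 hKR
  refine ⟨⌈K * R ^ (d + 1)⌉₊, hQ0, ?_, ?_⟩
  · have h1 := Nat.le_ceil (K * R ^ (d + 1))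
    have h2 : (0 : ℝ) < ⌈K * R ^ (d + 1)⌉₊ := by exact_mod_cast hQ0
    have h3 := card_le_of_abs_le E hR hE
    rw [show 2 * (E.card * (d * R * (2 * π / ⌈K * R ^ (d + 1)⌉₊))) =
      E.card * (4 * π * d * R) / (⌈K * R ^ (d + 1)⌉₊ : ℝ) by ring, div_le_one h2]
    refine le_trans ?_ h1
    calc (E.card : ℝ) * (4 * π * d * R) ≤ 3 ^ d * R ^ d * (4 * π * d * R) := by gcongr
      _ = _ := by rw [hK]; ring
  · have h1 := (Nat.ceil_lt_add_one hKR.le).le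
    have h2 : (1 : ℝ) ≤ R ^ (d + 1) := one_le_pow₀ (by linarith)
    have h3 : (⌈K * R ^ (d + 1)⌉₊ : ℝ) ≤ R ^ (p + (d + 1)) := by
      calc (⌈K * R ^ (d + 1)⌉₊ : ℝ) ≤ (K + 1) * R ^ (d + 1) := by linarith
        _ ≤ R ^ p * R ^ (d + 1) := by
          gcongr
          exact hp.le.trans (by gcongr)
        _ = _ := (pow_add _ _ _).symm
    have h4 : (8 : ℝ) * (⌈K * R ^ (d + 1)⌉₊ : ℝ) ^ d ≤ R ^ (3 + (p + (d + 1)) * d) := by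
      rw [pow_add R 3, pow_mul R]
      have : (8 : ℝ) ≤ R ^ 3 := by
        calc (8 : ℝ) = 2 ^ 3 := by norm_num
          _ ≤ R ^ 3 := by gcongr
      gcongr
    rw [← Real.log_pow]
    have : (0 : ℝ) < ⌈K * R ^ (d + 1)⌉₊ := by exact_mod_cast hQ0
    exact Real.log_le_log (by positivity) h4

theorem stmt9 (d : ℕ) (hd : 1 ≤ d) :
    ∃ C : ℝ, 0 < C ∧ ∀ R : ℝ, 2 ≤ R → ∀ E : Finset (Fin d → ℤ), E.Nonempty →
      (∀ k ∈ E, ∀ j, |(k j : ℝ)| ≤ R) →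
      ∀ m : ℕ, 1 ≤ m → m ≤ E.card →
      dK (SE d 2 E) m ≤ C * Real.sqrt ((E.card * Real.log R) / m) := by
  obtain ⟨P, hP, hgrid⟩ := exists_grid_size d hd
  have hP' : (1 : ℝ) ≤ P := by exact_mod_cast hP
  refine ⟨4 * √(288 * (96 * P)), by positivity, fun R hR E hEn hE m hm _ => ?_⟩
  have hn : (0 : ℝ) < E.card := by exact_mod_cast hEn.card_pos
  have hm' : (1 : ℝ) ≤ m := by exact_mod_cast hm
  set ℓ := Real.log R with hℓ
  have hℓ2 : 1 / 2 < ℓ := by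
    have h1 := Real.log_two_gt_d9
    have h2 := Real.log_le_log (by norm_num) hR
    linarith
  have hPℓ : 1 / 2 < P * ℓ := by nlinarith
  rw [mul_assoc, ← Real.sqrt_mul (by positivity)]
  by_cases hbig : (m : ℝ) - 1 < 24 * (P * ℓ)
  · refine dK_le _ ⊥ (by rw [finrank_bot]; exact hm) (by positivity) fun f hf => ⟨0, Submodule.zero_mem _, ?_⟩
    rw [sub_zero]
    refine (norm_SE_le E f hf).trans ?_
    have h1 : √(E.card : ℝ) ≤ √(288 * (96 * P) * (E.card * ℓ / m)) := by
      refine Real.sqrt_le_sqrt ?_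
      rw [← mul_div_assoc, le_div_iff₀ (by linarith)]
      nlinarith
    linarith [Real.sqrt_nonneg (288 * (96 * P) * (E.card * ℓ / m))]
  · rw [not_lt] at hbig
    obtain ⟨Q, hQ, hQR, hlog⟩ := hgrid R hR E hE
    set k := ⌊((m : ℝ) - 1) / (24 * (P * ℓ))⌋₊ with hkdef
    have hden : 0 < 24 * (P * ℓ) := by linarith
    have h1 : 1 ≤ ((m : ℝ) - 1) / (24 * (P * ℓ)) := by rwa [one_le_div hden]
    have hk : 0 < k := Nat.floor_pos.2 h1
    have hkR : (1 : ℝ) ≤ k := by exact_mod_cast hk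
    have hk1 : (k : ℝ) * (24 * (P * ℓ)) ≤ m - 1 :=
      (le_div_iff₀ hden).1 (Nat.floor_le (by linarith))
    have hk2 : (m : ℝ) - 1 < (k + 1) * (24 * (P * ℓ)) :=
      (div_lt_iff₀ hden).1 (Nat.lt_floor_add_one _)
    have hm1 : ((m - 1 : ℕ) : ℝ) = m - 1 := by push_cast [Nat.cast_sub hm]; ring
    have hm0 : 0 < m - 1 := by
      have : (0 : ℝ) < ((m - 1 : ℕ) : ℝ) := by rw [hm1]; linarith
      exact_mod_cast this
    obtain ⟨L, hLf, hLr, hL⟩ := exists_subspace_approx_SE hQ E hEn hE hQR (m - 1) k hm0 hk (by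
      rw [hm1]
      have : (k : ℝ) * Real.log (8 * (Q : ℝ) ^ d) ≤ k * (P * ℓ) := by gcongr
      nlinarith)
    refine dK_le _ L (by omega) (by positivity) fun f hf => ?_
    obtain ⟨b, hb, hfb⟩ := hL f hf
    refine ⟨b, hb, hfb.trans ?_⟩
    gcongr 4 * √?_
    rw [← mul_div_assoc, div_le_div_iff₀ (by linarith) (by linarith)]
    have h5 : (m : ℝ) ≤ 96 * (P * ℓ) * k := by
      have : P * ℓ ≤ P * ℓ * k := le_mul_of_one_le_right (by linarith) hkR
      linarith
    calc 288 * (E.card : ℝ) * m ≤ 288 * E.card * (96 * (P * ℓ) * k) := by gcongr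
      _ = _ := by ring

end
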